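/- arXiv:2501.10354 — 3 statements merged into one kernel-verified Lean document; each statement's English description precedes it below -/
import Mathlib

section
/- Let n, t, r, d be positive integers with n ≥ max{r+1, d−1}, and suppose M₀ := ⌈n·p₁(r,t)⌉ ≥ 2. Suppose every j ∈ [n] is assigned t subsets Γ₁(j),…,Γ_t(j) ⊆ [n] such that j ∈ Γ_α(j), |Γ_α(j)| ≤ r+1 for all α, and Γ_α(j) ∩ Γ_β(j) = {j} for all distinct α, β. Then there exist pairwise distinct j₁,…,j_M ∈ [n] with M = (d−1) + N₁(n,r,d,M₀) such that for every k with d ≤ k ≤ M there is at least one α ∈ [t] with Γ_α(j_k) ∩ {j₁, j₂, …, j_{k−1}} = ∅. -/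
/-- `p₁(r,t) = 1 − 1/∏_{l=1}^{t}(1 + 1/(l·r))`. -/
def p1 (r t : ℕ) : ℚ :=
  1 - 1 / ∏ l ∈ Finset.Icc 1 t, (1 + 1 / ((l : ℚ) * (r : ℚ)))

/-- `N₁(n,r,d,M)`: the largest integer `N` with `0 ≤ N ≤ M` such that
`N(r+1) − [N(N−1)/(M(M−1))]·(M(r+1)−n) ≤ n−(d−1)` as rational numbers. -/
def N1 (n r d M : ℕ) : ℕ :=
  ((Finset.range (M + 1)).filter (fun N : ℕ =>
    (N : ℚ) * ((r : ℚ) + 1) -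
      ((N : ℚ) * ((N : ℚ) - 1)) / ((M : ℚ) * ((M : ℚ) - 1)) *
        ((M : ℚ) * ((r : ℚ) + 1) - (n : ℚ))
      ≤ (n : ℚ) - ((d : ℚ) - 1))).sup id

open Finset

lemma card_filter_mem_powersetCard {ι : Type*} [DecidableEq ι] {U : Finset ι} {a : ι}
    (ha : a ∈ U) (N : ℕ) :
    (#U : ℚ) * #{S ∈ U.powersetCard N | a ∈ S} = N * (#U).choose N := by
  cases N with
  | zero => simp [filter_singleton]
  | succ k =>
    have h := card_filter_powersetCard_subset {a} U (k + 1) (by simpa) (by simp)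
    simp only [card_singleton, singleton_subset_iff] at h
    obtain ⟨m, hm⟩ : ∃ m, #U = m + 1 := ⟨#U - 1, by have := card_pos.2 ⟨a, ha⟩; omega⟩
    rw [h, hm, Nat.add_sub_cancel, Nat.add_sub_cancel, mul_comm ((k + 1 : ℕ) : ℚ)]
    exact_mod_cast Nat.add_one_mul_choose_eq m k

lemma card_filter_pair_mem_powersetCard {ι : Type*} [DecidableEq ι] {U : Finset ι} {a b : ι}
    (ha : a ∈ U) (hb : b ∈ U) (hab : a ≠ b) (N : ℕ) :
    (#U : ℚ) * (#U - 1) * #{S ∈ U.powersetCard N | a ∈ S ∧ b ∈ S} =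
      N * (N - 1) * (#U).choose N := by
  have hsub : {a, b} ⊆ U := by simp [insert_subset_iff, ha, hb]
  obtain ⟨m, hm⟩ : ∃ m, #U = m + 2 :=
    ⟨#U - 2, by have := card_le_card hsub; rw [card_pair hab] at this; omega⟩
  match N with
  | 0 => simp [filter_singleton]
  | 1 =>
    rw [filter_false_of_mem]
    · simp
    · rintro S hS ⟨h1, h2⟩
      exact hab (card_le_one.1 (mem_powersetCard.1 hS).2.le _ h1 _ h2)
  | k + 2 =>
    have h := card_filter_powersetCard_subset {a, b} U (k + 2) hsub (by simp [card_pair hab])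
    simp only [card_pair hab, insert_subset_iff, singleton_subset_iff] at h
    rw [h, hm, Nat.add_sub_cancel, Nat.add_sub_cancel]
    have h1 : ((m + 1 : ℕ) : ℚ) * m.choose k = (m + 1).choose (k + 1) * (k + 1 : ℕ) := by
      exact_mod_cast Nat.add_one_mul_choose_eq m k
    have h2 : ((m + 2 : ℕ) : ℚ) * (m + 1).choose (k + 1) =
        (m + 2).choose (k + 2) * (k + 2 : ℕ) := by
      exact_mod_cast Nat.add_one_mul_choose_eq (m + 1) (k + 1)
    push_cast at *
    linear_combination (m + 2 : ℚ) * h1 + (k + 1 : ℚ) * h2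

lemma exists_subset_card_biUnion_le {ι κ : Type*} [DecidableEq ι] [DecidableEq κ] [Fintype κ]
    (U : Finset ι) (G : ι → Finset κ) (r N : ℕ) (hG : ∀ j ∈ U, #(G j) ≤ r + 1)
    (hU : 2 ≤ #U) (hN : N ≤ #U) :
    ∃ S ⊆ U, #S = N ∧ (#(S.biUnion G) : ℚ) ≤ (N : ℚ) * ((r : ℚ) + 1) -
      ((N : ℚ) * ((N : ℚ) - 1)) / ((#U : ℚ) * ((#U : ℚ) - 1)) *
        ((#U : ℚ) * ((r : ℚ) + 1) - (Fintype.card κ : ℚ)) := by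
  set P := U.powersetCard N
  set M : ℚ := (#U : ℚ)
  set C : ℚ := ((#U).choose N : ℚ)
  have hM : (2 : ℚ) ≤ M := Nat.ofNat_le_cast.2 hU
  have hNM : (N : ℚ) ≤ M := Nat.cast_le.2 hN
  set p : ℚ := N / M
  set q : ℚ := (N : ℚ) * (N - 1) / (M * (M - 1))
  have hCP : (#P : ℚ) = C := by simp [P, C]
  have hC : 0 < C := Nat.cast_pos.2 (Nat.choose_pos hN)
  have hN1 : 0 ≤ (N : ℚ) * (N - 1) := by
    rcases Nat.eq_zero_or_pos N with h | h
    · simp [h]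
    · have : (1 : ℚ) ≤ N := by exact_mod_cast h
      exact mul_nonneg (by positivity) (by linarith)
  have hq : 0 ≤ q := div_nonneg hN1 (mul_nonneg (by linarith) (by linarith))
  have hqp : q ≤ p := by
    rw [div_le_div_iff₀ (mul_pos (by linarith) (by linarith)) (by linarith)]
    have : 0 ≤ (N : ℚ) * M * (M - N) := by
      have : 0 ≤ M - N := by linarith
      positivity
    nlinarith
  have h1 (a) (ha : a ∈ U) : (#{S ∈ P | a ∈ S} : ℚ) = p * C := by
    have := card_filter_mem_powersetCard ha N
    simp only [p]
    field_simp
    linear_combination this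
  have h2 (a) (ha : a ∈ U) (b) (hb : b ∈ U) (hab : a ≠ b) :
      (#{S ∈ P | a ∈ S ∧ b ∈ S} : ℚ) = q * C := by
    have := card_filter_pair_mem_powersetCard ha hb hab N
    have h3 : M - 1 ≠ 0 := by linarith
    simp only [q]
    field_simp
    linear_combination this
  have key (x : κ) : (#{S ∈ P | x ∈ S.biUnion G} : ℚ) ≤
      (#{j ∈ U | x ∈ G j} * (p - q) + q) * C := by
    set A := {j ∈ U | x ∈ G j} with hA
    have hmem {S} (hS : S ∈ P) : x ∈ S.biUnion G ↔ ∃ a ∈ A, a ∈ S := by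
      have := (mem_powersetCard.1 hS).1
      simp only [mem_biUnion, hA, mem_filter]
      exact ⟨fun ⟨a, h, h'⟩ ↦ ⟨a, ⟨this h, h'⟩, h⟩, fun ⟨a, h, h'⟩ ↦ ⟨a, h', h.2⟩⟩
    rcases A.eq_empty_or_nonempty with hE | ⟨a, ha⟩
    · rw [filter_false_of_mem]
      · simp only [hE, card_empty]; push_cast; nlinarith
      · intro S hS; rw [hmem hS]; simp [hE]
    have hAU : A ⊆ U := filter_subset _ _
    calc (#{S ∈ P | x ∈ S.biUnion G} : ℚ)
        = ∑ S ∈ P, if x ∈ S.biUnion G then (1 : ℚ) else 0 := by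
          simp only [card_filter]; push_cast; rfl
      _ ≤ ∑ S ∈ P, (∑ b ∈ A, (if b ∈ S then (1 : ℚ) else 0) -
            ∑ b ∈ A.erase a, if a ∈ S ∧ b ∈ S then (1 : ℚ) else 0) := by
          refine sum_le_sum fun S hS ↦ ?_
          by_cases haS : a ∈ S
          · rw [if_pos ((hmem hS).2 ⟨a, ha, haS⟩), ← add_sum_erase _ _ ha]
            simp [haS]
          · simp only [haS, false_and, if_false, sum_const_zero, sub_zero]
            split_ifs with h
            · obtain ⟨b, hb, hbS⟩ := (hmem hS).1 h
              calc (1 : ℚ) = if b ∈ S then 1 else 0 := by simp [hbS]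
                _ ≤ _ := single_le_sum (f := fun b ↦ if b ∈ S then (1 : ℚ) else 0)
                  (fun _ _ ↦ by positivity) hb
            · exact sum_nonneg fun _ _ ↦ by positivity
      _ = ∑ b ∈ A, (#{S ∈ P | b ∈ S} : ℚ) - ∑ b ∈ A.erase a, (#{S ∈ P | a ∈ S ∧ b ∈ S} : ℚ) := by
          rw [sum_sub_distrib, sum_comm, sum_comm (s := P) (t := A.erase a)]
          simp only [card_filter]; push_cast; rfl
      _ = #A * (p * C) - (#A - 1) * (q * C) := by
          rw [sum_congr rfl fun b hb ↦ h1 b (hAU hb), sum_congr rfl fun b hb ↦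
            h2 a (hAU ha) b (hAU (mem_of_mem_erase hb)) (ne_of_mem_erase hb).symm]
          have : 1 ≤ #A := card_pos.2 ⟨a, ha⟩
          simp [card_erase_of_mem ha, Nat.cast_sub this]
      _ = _ := by ring
  have hsum : ∑ S ∈ P, (#(S.biUnion G) : ℚ) ≤
      ∑ S ∈ P, ((N : ℚ) * (r + 1) - q * (M * (r + 1) - Fintype.card κ)) := by
    calc ∑ S ∈ P, (#(S.biUnion G) : ℚ) = ∑ x : κ, (#{S ∈ P | x ∈ S.biUnion G} : ℚ) := by
          have := sum_card_bipartiteAbove_eq_sum_card_bipartiteBelow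
            (s := P) (t := univ) (fun (S : Finset ι) x ↦ x ∈ S.biUnion G)
          simp only [bipartiteAbove, bipartiteBelow, filter_mem_eq_inter, univ_inter] at this
          exact_mod_cast this
      _ ≤ ∑ x : κ, (#{j ∈ U | x ∈ G j} * (p - q) + q) * C := sum_le_sum fun x _ ↦ key x
      _ = ((∑ j ∈ U, (#(G j) : ℚ)) * (p - q) + Fintype.card κ * q) * C := by
          rw [← sum_mul, sum_add_distrib, ← sum_mul]
          simp only [sum_const, card_univ, nsmul_eq_mul]
          congr 3
          have := sum_card_bipartiteAbove_eq_sum_card_bipartiteBelow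
            (s := U) (t := univ) (fun j x ↦ x ∈ G j)
          simp only [bipartiteAbove, bipartiteBelow, filter_mem_eq_inter, univ_inter] at this
          exact_mod_cast this.symm
      _ ≤ ((∑ j ∈ U, ((r : ℚ) + 1)) * (p - q) + Fintype.card κ * q) * C := by
          gcongr with j hj
          exact_mod_cast hG j hj
      _ = _ := by
          simp only [sum_const, nsmul_eq_mul, hCP]
          have : M * p = N := by simp only [p]; field_simp
          change (M * (r + 1) * (p - q) + Fintype.card κ * q) * C = _
          linear_combination (r + 1 : ℚ) * C * this
  obtain ⟨S, hS, hle⟩ := exists_le_of_sum_le (powersetCard_nonempty.2 hN) hsum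
  exact ⟨S, (mem_powersetCard.1 hS).1, (mem_powersetCard.1 hS).2, hle⟩


lemma card_filter_perm_lt {n : ℕ} (j : Fin n) (B : Finset (Fin n)) (hj : j ∉ B) :
    (#B + 1) * #{σ : Equiv.Perm (Fin n) | ∀ i ∈ B, σ i < σ j} = n.factorial := by
  let F (c : Fin n) : Finset (Equiv.Perm (Fin n)) := {σ | ∀ i ∈ insert j B, i ≠ c → σ i < σ c}
  have hmaps (c d) (hc : c ∈ insert j B) (hd : d ∈ insert j B) (σ) (hσ : σ ∈ F c) :
      σ * Equiv.swap c d ∈ F d := by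
    simp only [F, mem_filter_univ, Equiv.Perm.mul_apply, Equiv.swap_apply_right] at hσ ⊢
    intro i hi hid
    rcases eq_or_ne i c with rfl | hic
    · rw [Equiv.swap_apply_left]
      exact hσ d hd hid.symm
    · rw [Equiv.swap_apply_of_ne_of_ne hic hid]
      exact hσ i hi hic
  have hjC : j ∈ insert j B := mem_insert_self _ _
  have hcard (c) (hc : c ∈ insert j B) : #(F c) = #(F j) :=
    card_nbij' (· * Equiv.swap c j) (· * Equiv.swap j c) (fun σ ↦ hmaps c j hc hjC σ)
      (fun σ ↦ hmaps j c hjC hc σ) (fun σ _ ↦ by simp [mul_assoc, Equiv.swap_comm j c])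
      (fun σ _ ↦ by simp [mul_assoc, Equiv.swap_comm j c])
  have hdisj : ((insert j B : Finset (Fin n)) : Set (Fin n)).PairwiseDisjoint F := by
    intro c hc d hd hcd
    refine disjoint_left.2 fun σ h1 h2 ↦ ?_
    simp only [F, mem_filter_univ] at h1 h2
    exact lt_asymm (h1 d hd hcd.symm) (h2 c hc hcd)
  have hunion : (insert j B).biUnion F = univ := by
    refine eq_univ_of_forall fun σ ↦ mem_biUnion.2 ?_
    obtain ⟨c, hc, hmax⟩ := exists_max_image (insert j B) σ ⟨j, hjC⟩
    refine ⟨c, hc, ?_⟩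
    simp only [F, mem_filter_univ]
    exact fun i hi hic ↦ (hmax i hi).lt_of_ne (σ.injective.ne hic)
  have hF : F j = ({σ : Equiv.Perm (Fin n) | ∀ i ∈ B, σ i < σ j} : Finset _) := by
    ext σ
    simp only [F, mem_filter_univ, mem_insert]
    exact ⟨fun h i hi ↦ h i (.inr hi) (ne_of_mem_of_not_mem hi hj),
      fun h i hi hij ↦ h i (hi.resolve_left hij)⟩
  rw [← hF, ← card_insert_of_notMem hj, ← smul_eq_mul, ← sum_const, ← sum_congr rfl hcard,
    ← card_biUnion hdisj, hunion, card_univ, Fintype.card_perm, Fintype.card_fin]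

open intervalIntegral in
lemma integral_one_sub_pow_pow (r t : ℕ) (hr : 0 < r) :
    ∫ x in (0 : ℝ)..1, (1 - x ^ r) ^ t = 1 / ∏ l ∈ Icc 1 t, (1 + 1 / ((l : ℝ) * (r : ℝ))) := by
  have hint (m : ℕ) : IntervalIntegrable (fun x : ℝ ↦ (1 - x ^ r) ^ m) MeasureTheory.volume 0 1 :=
    (by fun_prop : Continuous fun x : ℝ ↦ (1 - x ^ r) ^ m).intervalIntegrable _ _
  induction t with
  | zero => simp
  | succ t ih =>
    have hderiv (x : ℝ) : HasDerivAt (fun x : ℝ ↦ x * (1 - x ^ r) ^ (t + 1))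
        ((1 + (t + 1) * r) * (1 - x ^ r) ^ (t + 1) - (t + 1) * r * (1 - x ^ r) ^ t) x := by
      have h := (hasDerivAt_id x).mul (((hasDerivAt_pow r x).const_sub 1).pow (t + 1))
      refine h.congr_deriv ?_
      obtain ⟨s, rfl⟩ : ∃ s, r = s + 1 := ⟨r - 1, by omega⟩
      simp
      ring
    have h := integral_eq_sub_of_hasDerivAt (fun x _ ↦ hderiv x)
      (((hint (t + 1)).const_mul _).sub ((hint t).const_mul _))
    rw [integral_sub ((hint _).const_mul _) ((hint _).const_mul _), integral_const_mul,
      integral_const_mul, ih] at h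
    rw [prod_Icc_succ_top (by omega)]
    set P := ∏ l ∈ Icc 1 t, (1 + 1 / ((l : ℝ) * (r : ℝ)))
    have hP : 0 < P := prod_pos fun l _ ↦ by positivity
    have hr' : (0 : ℝ) < r := by exact_mod_cast hr
    simp [hr.ne'] at h
    push_cast
    have h1 : (1 + (t + 1) * r) * (∫ x in (0 : ℝ)..1, (1 - x ^ r) ^ (t + 1)) = (t + 1) * r * P⁻¹ := by
      linarith
    field_simp at h1 ⊢
    linarith

lemma card_filter_perm_le {n : ℕ} (j : Fin n) (r t : ℕ) (hr : 0 < r) (B : Fin t → Finset (Fin n))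
    (hj : ∀ α, j ∉ B α) (hB : ∀ α, #(B α) ≤ r) (hdisj : Pairwise (Function.onFun Disjoint B)) :
    (#{σ : Equiv.Perm (Fin n) | ∀ α, ∃ i ∈ B α, σ j ≤ σ i} : ℝ) ≤
      n.factorial * (1 / ∏ l ∈ Icc 1 t, (1 + 1 / ((l : ℝ) * (r : ℝ)))) := by
  have hint (T : Finset (Fin t)) : ∑ σ : Equiv.Perm (Fin n),
      ∏ α ∈ T, (if ∀ i ∈ B α, σ i < σ j then (1 : ℝ) else 0) =
      n.factorial * ∫ x in (0 : ℝ)..1, ∏ α ∈ T, x ^ #(B α) := by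
    have h1 (σ : Equiv.Perm (Fin n)) :
        ∏ α ∈ T, (if ∀ i ∈ B α, σ i < σ j then (1 : ℝ) else 0) =
          if ∀ i ∈ T.biUnion B, σ i < σ j then 1 else 0 := by
      rw [prod_ite_zero]
      simp only [prod_const_one, mem_biUnion]
      congr 1
      simp only [eq_iff_iff]
      exact ⟨fun h i ⟨α, hα, hi⟩ ↦ h α hα i hi, fun h α hα i hi ↦ h i ⟨α, hα, hi⟩⟩
    have h2 := card_filter_perm_lt j (T.biUnion B) (by simp [hj])
    rw [card_biUnion fun α _ β _ h ↦ hdisj h] at h2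
    simp_rw [h1, prod_pow_eq_pow_sum, integral_pow]
    rw [← h2]
    simp
    field_simp
  have hexp : ∑ σ : Equiv.Perm (Fin n),
      ∏ α, (1 - if ∀ i ∈ B α, σ i < σ j then (1 : ℝ) else 0) =
      n.factorial * ∫ x in (0 : ℝ)..1, ∏ α, (1 - x ^ #(B α)) := by
    simp_rw [prod_sub, prod_const_one, mul_one]
    rw [intervalIntegral.integral_finsetSum fun T _ ↦
      (by fun_prop : Continuous _).intervalIntegrable _ _, sum_comm, mul_sum]
    refine sum_congr rfl fun T _ ↦ ?_
    rw [intervalIntegral.integral_const_mul, ← mul_sum, hint]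
    ring
  calc (#{σ : Equiv.Perm (Fin n) | ∀ α, ∃ i ∈ B α, σ j ≤ σ i} : ℝ)
      = ∑ σ : Equiv.Perm (Fin n), ∏ α, (1 - if ∀ i ∈ B α, σ i < σ j then (1 : ℝ) else 0) := by
        rw [card_filter]
        push_cast
        refine sum_congr rfl fun σ _ ↦ ?_
        have h (α : Fin t) : (1 - if ∀ i ∈ B α, σ i < σ j then (1 : ℝ) else 0) =
            if ∃ i ∈ B α, σ j ≤ σ i then 1 else 0 := by
          split_ifs <;> grind
        simp_rw [h, prod_ite_zero]
        simp
    _ = _ := hexp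
    _ ≤ n.factorial * ∫ x in (0 : ℝ)..1, (1 - x ^ r) ^ t := by
        gcongr
        refine intervalIntegral.integral_mono_on zero_le_one
          ((by fun_prop : Continuous _).intervalIntegrable _ _)
          ((by fun_prop : Continuous _).intervalIntegrable _ _) fun x hx ↦ ?_
        calc ∏ α, (1 - x ^ #(B α)) ≤ ∏ α : Fin t, (1 - x ^ r) :=
              prod_le_prod (fun α _ ↦ sub_nonneg.2 (pow_le_one₀ hx.1 hx.2))
                fun α _ ↦ sub_le_sub_left (pow_le_pow_of_le_one hx.1 hx.2 (hB α)) _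
          _ = _ := by simp
    _ = _ := by rw [integral_one_sub_pow_pow r t hr]

lemma exists_perm_le_card {n t r : ℕ} (hr : 0 < r) (Γ : Fin n → Fin t → Finset (Fin n))
    (hmem : ∀ j α, j ∈ Γ j α) (hcard : ∀ j α, #(Γ j α) ≤ r + 1)
    (hint : ∀ j α β, α ≠ β → Γ j α ∩ Γ j β = {j}) :
    ∃ σ : Equiv.Perm (Fin n),
      (n : ℚ) * p1 r t ≤ #{j | ∃ α, ∀ i ∈ Γ j α, i ≠ j → σ i < σ j} := by
  set P : ℝ := 1 / ∏ l ∈ Icc 1 t, (1 + 1 / ((l : ℝ) * (r : ℝ)))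
  have hP : ((p1 r t : ℚ) : ℝ) = 1 - P := by simp [p1, P]
  have hbad (j : Fin n) : (#{σ : Equiv.Perm (Fin n) |
      ¬ ∃ α, ∀ i ∈ Γ j α, i ≠ j → σ i < σ j} : ℝ) ≤ n.factorial * P := by
    have h := card_filter_perm_le j r t hr (fun α ↦ (Γ j α).erase j) (by simp)
      (fun α ↦ by rw [card_erase_of_mem (hmem j α)]; have := hcard j α; omega)
      (fun α β hαβ ↦ disjoint_left.2 fun i hi hi' ↦ (mem_erase.1 hi).1 <| by
        rw [← mem_singleton, ← hint j α β hαβ]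
        exact mem_inter.2 ⟨mem_of_mem_erase hi, mem_of_mem_erase hi'⟩)
    convert h using 5 with σ
    push Not
    simp only [mem_erase, and_left_comm, and_assoc]
  have hsum : ∑ σ : Equiv.Perm (Fin n), (n : ℝ) * (1 - P) ≤
      ∑ σ : Equiv.Perm (Fin n), (#{j | ∃ α, ∀ i ∈ Γ j α, i ≠ j → σ i < σ j} : ℝ) := by
    have hcount := sum_card_bipartiteAbove_eq_sum_card_bipartiteBelow
      (s := (univ : Finset (Equiv.Perm (Fin n)))) (t := univ)
      (fun σ j ↦ ∃ α, ∀ i ∈ Γ j α, i ≠ j → σ i < σ j)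
    simp only [bipartiteAbove, bipartiteBelow] at hcount
    rw [← Nat.cast_sum, hcount, Nat.cast_sum]
    calc ∑ σ : Equiv.Perm (Fin n), (n : ℝ) * (1 - P)
        = ∑ j : Fin n, ((n.factorial : ℝ) - n.factorial * P) := by
          simp [Fintype.card_perm]
          ring
      _ ≤ _ := sum_le_sum fun j _ ↦ by
          have h : #{σ : Equiv.Perm (Fin n) | ∃ α, ∀ i ∈ Γ j α, i ≠ j → σ i < σ j} +
              #{σ : Equiv.Perm (Fin n) | ¬ ∃ α, ∀ i ∈ Γ j α, i ≠ j → σ i < σ j} =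
              n.factorial := by
            rw [card_filter_add_card_filter_not, card_univ, Fintype.card_perm, Fintype.card_fin]
          have h' := hbad j
          rw [sub_le_iff_le_add]
          refine le_trans (le_of_eq ?_) (add_le_add_right h' _)
          rw [← h, Nat.cast_add]
  obtain ⟨σ, -, hσ⟩ := exists_le_of_sum_le univ_nonempty hsum
  refine ⟨σ, ?_⟩
  rw [← hP] at hσ
  exact_mod_cast hσ

lemma N1_le_and_bound {n r d M : ℕ} (hd : 0 < d) (hdn : d - 1 ≤ n) :
    N1 n r d M ≤ M ∧ (N1 n r d M : ℚ) * ((r : ℚ) + 1) -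
      ((N1 n r d M : ℚ) * ((N1 n r d M : ℚ) - 1)) / ((M : ℚ) * ((M : ℚ) - 1)) *
        ((M : ℚ) * ((r : ℚ) + 1) - (n : ℚ)) + ((d - 1 : ℕ) : ℚ) ≤ n := by
  have hdc : ((d - 1 : ℕ) : ℚ) = (d : ℚ) - 1 := by push_cast [Nat.cast_sub hd]; simp
  have hdn' : ((d - 1 : ℕ) : ℚ) ≤ n := by exact_mod_cast hdn
  obtain ⟨N, hN, hsup⟩ := exists_mem_eq_sup ((range (M + 1)).filter (fun N : ℕ =>
    (N : ℚ) * ((r : ℚ) + 1) -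
      ((N : ℚ) * ((N : ℚ) - 1)) / ((M : ℚ) * ((M : ℚ) - 1)) *
        ((M : ℚ) * ((r : ℚ) + 1) - (n : ℚ))
      ≤ (n : ℚ) - ((d : ℚ) - 1))) ⟨0, by simp; linarith⟩ id
  have hN1 : N1 n r d M = N := hsup
  simp only [mem_filter, mem_range] at hN
  rw [hN1]
  exact ⟨by omega, by linarith⟩

theorem exists_recoverable_sequence (n t r d : ℕ)
    (hn : 0 < n) (ht : 0 < t) (hr : 0 < r) (hd : 0 < d)
    (hmax : max (r + 1) (d - 1) ≤ n)
    (M₀ : ℕ) (hM₀ : M₀ = (⌈(n : ℚ) * p1 r t⌉).toNat) (hM₀2 : 2 ≤ M₀)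
    (Γ : Fin n → Fin t → Finset (Fin n))
    (hmem : ∀ j α, j ∈ Γ j α)
    (hcard : ∀ j α, (Γ j α).card ≤ r + 1)
    (hint : ∀ j α β, α ≠ β → Γ j α ∩ Γ j β = {j}) :
    ∃ f : Fin ((d - 1) + N1 n r d M₀) → Fin n,
      Function.Injective f ∧
      ∀ k : Fin ((d - 1) + N1 n r d M₀), d ≤ (k : ℕ) + 1 →
        ∃ α : Fin t, ∀ i : Fin ((d - 1) + N1 n r d M₀), i < k → f i ∉ Γ (f k) α := by
  obtain ⟨hNM, hNn⟩ := N1_le_and_bound (n := n) (r := r) (M := M₀) hd (le_of_max_le_right hmax)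
  set N := N1 n r d M₀
  obtain ⟨σ, hσ⟩ := exists_perm_le_card hr Γ hmem hcard hint
  have hM₀le : M₀ ≤ #{j | ∃ α, ∀ i ∈ Γ j α, i ≠ j → σ i < σ j} := by
    rw [hM₀, Int.toNat_le, Int.ceil_le]
    exact_mod_cast hσ
  obtain ⟨U, hU, hUcard⟩ := exists_subset_card_eq hM₀le
  have : Nonempty (Fin t) := ⟨⟨0, ht⟩⟩
  choose! a ha using fun j (hj : j ∈ U) ↦ (mem_filter_univ j).1 (hU hj)
  obtain ⟨S, hSU, hS, hSle⟩ := exists_subset_card_biUnion_le U (fun j ↦ Γ j (a j)) r N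
    (fun j _ ↦ hcard j (a j)) (hUcard ▸ hM₀2) (hUcard ▸ hNM)
  rw [hUcard, Fintype.card_fin] at hSle
  have hcompl : d - 1 ≤ #(S.biUnion fun j ↦ Γ j (a j))ᶜ := by
    have h : #(S.biUnion fun j ↦ Γ j (a j)) + (d - 1) ≤ n := by
      have := (add_le_add_left hSle ((d - 1 : ℕ) : ℚ)).trans hNn
      exact_mod_cast this
    rw [card_compl, Fintype.card_fin]
    omega
  obtain ⟨D, hDsub, hD⟩ := exists_subset_card_eq hcompl
  have hDS {x y : Fin n} (hx : x ∈ D) (hy : y ∈ S) : x ∉ Γ y (a y) := fun h ↦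
    mem_compl.1 (hDsub hx) (mem_biUnion.2 ⟨y, hy, h⟩)
  let u := D.orderEmbOfFin hD
  let e := (S.map σ.toEmbedding).orderEmbOfFin (by rw [card_map, hS])
  let v (i : Fin N) : Fin n := σ.symm (e i.rev)
  have hu (i) : u i ∈ D := orderEmbOfFin_mem _ _ _
  have hv (i) : v i ∈ S := by
    have := orderEmbOfFin_mem (S.map σ.toEmbedding) (by rw [card_map, hS]) i.rev
    simpa [mem_map_equiv] using this
  refine ⟨Fin.append u v, Fin.append_injective_iff.2 ⟨u.injective,
    σ.symm.injective.comp (e.injective.comp Fin.rev_injective), fun i j h ↦ ?_⟩, ?_⟩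
  · exact hDS (hu i) (hv j) (h ▸ hmem _ _)
  · intro k
    refine Fin.addCases (fun k hk ↦ ?_) (fun k _ ↦ ⟨a (v k), fun i ↦ ?_⟩) k
    · have := k.isLt
      rw [Fin.val_castAdd] at hk
      omega
    · rw [Fin.append_right]
      refine Fin.addCases (fun i _ ↦ ?_) (fun i hik ↦ ?_) i
      · rw [Fin.append_left]
        exact hDS (hu i) (hv k)
      · rw [Fin.append_right]
        have hlt : σ (v k) < σ (v i) := by
          simpa [v] using hik
        exact fun h ↦ lt_asymm hlt <|
          ha (v k) (hSU (hv k)) (v i) h (ne_of_apply_ne σ hlt.ne')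
end

section
/- Let (Γ_l(j))_{1≤l≤t, 1≤j≤n} be a family of subsets of [n] satisfying the exact (r,t,s)-condition, let d ≥ 1 with d−1 < n, and let A ⊆ [n] be a set with n−|A| ≥ max{r+1, d−1}. Suppose M₀ := ⌈(n−|A|)·p_e(r,t,s)⌉ ≥ 2. Then there exist pairwise distinct j₁,…,j_M ∈ [n]∖A with M = (d−1) + N₁(n−|A|, r, d, M₀) such that for every k with d ≤ k ≤ M there is at least one α ∈ [t] with Γ_α(j_k) ∩ {j₁, j₂, …, j_{k−1}} = ∅. -/
/-- The family `(Γ_l(j))` of subsets of `[n]` satisfies the exact `(r,t,s)`-condition. -/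
def ExactCondition (n r t s : ℕ) (Γ : Fin n → Fin t → Finset (Fin n)) : Prop :=
  (∀ (j : Fin n) (l : Fin t), (Γ j l).card = r + 1 ∧ j ∈ Γ j l) ∧
  (∀ (j : Fin n) (l₁ l₂ : Fin t), l₁ ≠ l₂ → (Γ j l₁ ∩ Γ j l₂).card = s + 1) ∧
  (∀ (j : Fin n) (l₁ l₂ l₃ : Fin t), l₁ ≠ l₂ → l₁ ≠ l₃ → l₂ ≠ l₃ →
    Γ j l₁ ∩ Γ j l₂ ∩ Γ j l₃ = {j})

/-- `N_e(r,L,s) = 1 + Lr − s·L(L−1)/2` as a rational number. -/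
def NeQ (r L s : ℕ) : ℚ :=
  1 + (L : ℚ) * (r : ℚ) - (s : ℚ) * (L : ℚ) * ((L : ℚ) - 1) / 2

/-- `p_e(r,t,s) = Σ_{L=1}^{t} (−1)^{L+1}·C(t,L)/N_e(r,L,s)`. -/
def pe (r t s : ℕ) : ℚ :=
  ∑ L ∈ Finset.Icc 1 t, (-1 : ℚ) ^ (L + 1) * (t.choose L : ℚ) / NeQ r L s

open Finset in
theorem card_filter_inter_nonempty_le {β : Type*} [DecidableEq β] (B C : Finset β) (N : ℕ)
    (hN : 2 ≤ N) (hNB : N ≤ #B) (hCB : C ⊆ B) :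
    (#{K ∈ B.powersetCard N | (K ∩ C).Nonempty} : ℚ) ≤
      (#B).choose N * ((N : ℚ) / #B * #C -
        ((N : ℚ) * (N - 1)) / ((#B : ℚ) * (#B - 1)) * (#C - 1)) := by
  have hN' : (2 : ℚ) ≤ N := by exact_mod_cast hN
  have hB' : (2 : ℚ) ≤ #B := by exact_mod_cast hN.trans hNB
  rcases C.eq_empty_or_nonempty with rfl | ⟨c, hc⟩
  · simp only [inter_empty, Finset.not_nonempty_empty, filter_false, card_empty]
    have : 0 ≤ ((N : ℚ) * (N - 1)) / ((#B : ℚ) * (#B - 1)) :=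
      div_nonneg (mul_nonneg (by linarith) (by linarith)) (mul_nonneg (by linarith) (by linarith))
    have h2 : (0 : ℚ) ≤ (#B).choose N := by positivity
    push_cast
    nlinarith [mul_nonneg h2 this]
  have hone (b : β) (hb : b ∈ C) : (#{K ∈ B.powersetCard N | b ∈ K} : ℚ) =
      (#B).choose N * ((N : ℚ) / #B) := by
    have h := card_filter_powersetCard_subset {b} B N (by simpa using hCB hb)
      (by rw [card_singleton]; omega)
    have hch := Nat.choose_mul (n := #B) (k := N) (s := 1) (by omega)
    simp only [singleton_subset_iff, card_singleton] at h
    rw [h]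
    simp only [Nat.choose_one_right] at hch
    have hch' : ((#B).choose N : ℚ) * N = #B * (#B - 1).choose (N - 1) := by exact_mod_cast hch
    field_simp
    linarith
  have htwo (b : β) (hb : b ∈ C.erase c) : (#{K ∈ B.powersetCard N | b ∈ K ∧ c ∈ K} : ℚ) =
      (#B).choose N * (((N : ℚ) * (N - 1)) / ((#B : ℚ) * (#B - 1))) := by
    have hbc := (mem_erase.1 hb).1
    have h := card_filter_powersetCard_subset {b, c} B N
      (by simp [insert_subset_iff, hCB hc, hCB (mem_of_mem_erase hb)])
      (by rw [card_pair hbc]; omega)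
    have hch := Nat.choose_mul (n := #B) (k := N) (s := 2) hN
    simp only [insert_subset_iff, singleton_subset_iff, card_pair hbc] at h
    rw [h]
    have hch' : ((#B).choose N : ℚ) * (N.choose 2 : ℕ) =
      ((#B).choose 2 : ℕ) * (#B - 2).choose (N - 2) := by exact_mod_cast hch
    rw [Nat.cast_choose_two, Nat.cast_choose_two] at hch'
    have h1 : (#B : ℚ) - 1 ≠ 0 := by linarith
    field_simp
    linarith
  have hpoint : ∀ K ∈ B.powersetCard N, (if (K ∩ C).Nonempty then (1 : ℚ) else 0) ≤
      ∑ b ∈ C, (if b ∈ K then (1 : ℚ) else 0) -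
        ∑ b ∈ C.erase c, (if b ∈ K ∧ c ∈ K then (1 : ℚ) else 0) := by
    intro K _
    rw [← add_sum_erase C _ hc, add_sub_assoc, ← sum_sub_distrib]
    by_cases hcK : c ∈ K
    · simp only [hcK, and_true, sub_self, sum_const_zero]
      split_ifs <;> simp
    · simp only [hcK, and_false, if_false, sub_zero, zero_add]
      split_ifs with h
      · obtain ⟨b, hb⟩ := h
        rw [mem_inter] at hb
        have hbc : b ≠ c := by rintro rfl; exact hcK hb.1
        have := single_le_sum (f := fun b => if b ∈ K then (1 : ℚ) else 0)
          (fun i _ => by positivity) (mem_erase.2 ⟨hbc, hb.2⟩)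
        simpa [hb.1] using this
      · exact sum_nonneg fun i _ => by positivity
  have hsum := sum_le_sum hpoint
  rw [sum_sub_distrib, sum_comm, sum_comm (s := B.powersetCard N)] at hsum
  simp only [sum_boole] at hsum
  rw [sum_congr rfl hone, sum_congr rfl htwo, sum_const, sum_const, nsmul_eq_mul, nsmul_eq_mul,
    card_erase_of_mem hc, Nat.cast_sub (card_pos.2 ⟨c, hc⟩)] at hsum
  refine hsum.trans (le_of_eq ?_)
  push_cast
  ring

open Finset in
theorem exists_subset_card_biUnion_le_s8 {α β : Type*} [DecidableEq α] [DecidableEq β]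
    (B : Finset β) (T : β → Finset α) (V : Finset α) (q N : ℕ) (hTV : ∀ b ∈ B, T b ⊆ V)
    (hT : ∀ b ∈ B, #(T b) = q) (hNB : N ≤ #B) :
    ∃ K ⊆ B, #K = N ∧ (#(K.biUnion T) : ℚ) ≤ N * q -
      ((N : ℚ) * (N - 1)) / ((#B : ℚ) * (#B - 1)) * (#B * q - #V) := by
  rcases lt_or_ge N 2 with hN | hN
  · obtain ⟨K, hKB, hK⟩ := exists_subset_card_eq hNB
    refine ⟨K, hKB, hK, ?_⟩
    have h : (N : ℚ) * (N - 1) = 0 := by interval_cases N <;> norm_num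
    rw [h, zero_div, zero_mul, sub_zero, ← hK]
    exact_mod_cast card_biUnion_le_card_mul K T q fun b hb => (hT b (hKB hb)).le
  have hB' : (2 : ℚ) ≤ #B := by exact_mod_cast hN.trans hNB
  suffices h : ∃ K ∈ B.powersetCard N, (#(K.biUnion T) : ℚ) ≤ N * q -
      ((N : ℚ) * (N - 1)) / ((#B : ℚ) * (#B - 1)) * (#B * q - #V) by
    obtain ⟨K, hK, h⟩ := h
    rw [mem_powersetCard] at hK
    exact ⟨K, hK.1, hK.2, h⟩
  refine exists_le_of_sum_le (powersetCard_nonempty.2 hNB) ?_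
  have hcount : ∀ K ∈ B.powersetCard N, (#(K.biUnion T) : ℚ) =
      ∑ x ∈ V, if (K ∩ {b ∈ B | x ∈ T b}).Nonempty then (1 : ℚ) else 0 := by
    intro K hK
    rw [mem_powersetCard] at hK
    rw [sum_boole]
    congr 2
    ext x
    simp only [mem_biUnion, mem_filter, Finset.Nonempty, mem_inter]
    constructor
    · rintro ⟨b, hb, hx⟩
      exact ⟨hTV b (hK.1 hb) hx, b, hb, hK.1 hb, hx⟩
    · rintro ⟨-, b, hb, -, hx⟩
      exact ⟨b, hb, hx⟩
  have hdeg : ∑ x ∈ V, (#{b ∈ B | x ∈ T b} : ℚ) = #B * q := by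
    have h := sum_card_bipartiteAbove_eq_sum_card_bipartiteBelow (s := V) (t := B)
      (fun x b => x ∈ T b)
    have h2 : ∑ b ∈ B, #(bipartiteBelow (fun x b => x ∈ T b) V b) = #B * q := by
      rw [sum_const_nat]
      intro b hb
      rw [← hT b hb]
      congr 1
      ext x
      simpa [bipartiteBelow] using fun hx => hTV b hb hx
    rw [h2] at h
    exact_mod_cast h
  rw [sum_congr rfl hcount, sum_comm]
  simp only [sum_boole]
  refine (sum_le_sum fun x _ =>
    card_filter_inter_nonempty_le B _ N hN hNB (filter_subset _ _)).trans ?_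
  rw [← mul_sum, sum_sub_distrib, ← mul_sum, ← mul_sum, sum_sub_distrib, hdeg, sum_const,
    sum_const, card_powersetCard]
  simp only [nsmul_eq_mul, mul_one]
  refine le_of_eq ?_
  congr 2
  field_simp

open Finset in
theorem card_perm_min_mul_card {n : ℕ} (S : Finset (Fin n)) (j : Fin n) (hj : j ∈ S) :
    #{π : Equiv.Perm (Fin n) | ∀ x ∈ S, π j ≤ π x} * #S = n.factorial := by
  have hcard : ∀ a ∈ S, #{π : Equiv.Perm (Fin n) | ∀ x ∈ S, π a ≤ π x} =
      #{π : Equiv.Perm (Fin n) | ∀ x ∈ S, π j ≤ π x} := by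
    intro a ha
    have hswap : ∀ x ∈ S, Equiv.swap a j x ∈ S := by
      intro x hx
      rw [Equiv.swap_apply_def]
      split_ifs <;> assumption
    refine card_bij' (fun π _ => π * Equiv.swap a j) (fun π _ => π * Equiv.swap a j)
      ?_ ?_ ?_ ?_
    · intro π hπ
      simp only [mem_filter, mem_univ, true_and, Equiv.Perm.mul_apply,
        Equiv.swap_apply_right] at hπ ⊢
      exact fun x hx => hπ _ (hswap x hx)
    · intro π hπ
      simp only [mem_filter, mem_univ, true_and, Equiv.Perm.mul_apply,
        Equiv.swap_apply_left] at hπ ⊢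
      exact fun x hx => hπ _ (hswap x hx)
    · intro π _
      simp [mul_assoc]
    · intro π _
      simp [mul_assoc]
  have hdisj : (S : Set (Fin n)).PairwiseDisjoint
      fun a => ({π : Equiv.Perm (Fin n) | ∀ x ∈ S, π a ≤ π x} : Finset (Equiv.Perm (Fin n))) := by
    intro a ha b hb hab
    refine disjoint_left.2 fun π h1 h2 => hab ?_
    simp only [mem_filter, mem_univ, true_and] at h1 h2
    exact π.injective (le_antisymm (h1 b hb) (h2 a ha))
  have hunion : (S.biUnion
      fun a => ({π : Equiv.Perm (Fin n) | ∀ x ∈ S, π a ≤ π x} :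
        Finset (Equiv.Perm (Fin n)))) = univ := by
    ext π
    simp only [mem_biUnion, mem_filter, mem_univ, true_and, iff_true]
    exact exists_min_image S π ⟨j, hj⟩
  have hsum := card_biUnion hdisj
  rw [hunion, card_univ, Fintype.card_perm, Fintype.card_fin, sum_congr rfl hcard,
    sum_const, smul_eq_mul] at hsum
  rw [hsum, mul_comm]

open Finset in
theorem card_biUnion_of_pairwise_inter {ι α : Type*} [DecidableEq ι] [DecidableEq α]
    (G : ι → Finset α) (r s : ℕ) (hr : ∀ i, #(G i) = r)
    (hs : ∀ i k, i ≠ k → #(G i ∩ G k) = s)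
    (hG : ∀ i k l, i ≠ k → i ≠ l → k ≠ l → G i ∩ G k ∩ G l = ∅) (S : Finset ι) :
    (#(S.biUnion G) : ℚ) = #S * r - s * #S * (#S - 1) / 2 := by
  induction S using Finset.induction_on with
  | empty => simp
  | insert a S ha ih =>
    have hinter : #(G a ∩ S.biUnion G) = #S * s := by
      rw [inter_biUnion, card_biUnion, sum_const_nat]
      · exact fun i hi => hs a i fun h => ha (h ▸ hi)
      · intro i hi k hk hik
        rw [Function.onFun, disjoint_iff_inter_eq_empty, ← inter_inter_distrib_left,
          ← inter_assoc]
        exact hG a i k (fun h => ha (h ▸ hi)) (fun h => ha (h ▸ hk)) hik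
    have hunion := card_union_add_card_inter (G a) (S.biUnion G)
    rw [hinter, hr] at hunion
    have hunion' : (#(G a ∪ S.biUnion G) : ℚ) + #S * s = r + #(S.biUnion G) := by
      exact_mod_cast hunion
    rw [biUnion_insert, card_insert_of_notMem ha]
    push_cast
    rw [ih] at hunion'
    linarith

open Finset in
theorem card_biUnion_of_exactCondition {n r t s : ℕ} {Γ : Fin n → Fin t → Finset (Fin n)}
    (h : ExactCondition n r t s Γ) (j : Fin n) (S : Finset (Fin t)) (hS : S.Nonempty) :
    (#(S.biUnion (Γ j)) : ℚ) = NeQ r #S s := by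
  obtain ⟨h1, h2, h3⟩ := h
  have hunion : S.biUnion (Γ j) = insert j (S.biUnion fun l => (Γ j l).erase j) := by
    obtain ⟨l, hl⟩ := hS
    ext x
    simp only [mem_biUnion, mem_insert, mem_erase]
    have := (h1 j l).2
    by_cases hx : x = j <;> grind
  have hcard := card_biUnion_of_pairwise_inter (fun l => (Γ j l).erase j) r s
    (fun l => by rw [card_erase_of_mem (h1 j l).2, (h1 j l).1, Nat.add_sub_cancel])
    (fun k l hkl => by
      rw [erase_inter, inter_erase, erase_idem, card_erase_of_mem (mem_inter.2 ⟨(h1 j k).2, (h1 j l).2⟩),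
        h2 j k l hkl, Nat.add_sub_cancel])
    (fun k l m hkl hkm hlm => by
      simp [erase_inter, inter_erase, h3 j k l m hkl hkm hlm]) S
  rw [hunion, card_insert_of_notMem (by simp)]
  push_cast
  rw [hcard, NeQ]
  ring

open Finset in
theorem card_perm_exists_min {n r t s : ℕ} {Γ : Fin n → Fin t → Finset (Fin n)}
    (h : ExactCondition n r t s Γ) (j : Fin n) :
    (#{π : Equiv.Perm (Fin n) | ∃ l, ∀ x ∈ Γ j l, π j ≤ π x} : ℚ) = n.factorial * pe r t s := by
  have hunion : ({π : Equiv.Perm (Fin n) | ∃ l, ∀ x ∈ Γ j l, π j ≤ π x} :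
      Finset (Equiv.Perm (Fin n))) =
      univ.biUnion fun l => {π : Equiv.Perm (Fin n) | ∀ x ∈ Γ j l, π j ≤ π x} := by
    ext π
    simp
  have hinf (S : Finset (Fin t)) (hS : S.Nonempty) :
      (#(S.inf' hS fun l => ({π : Equiv.Perm (Fin n) | ∀ x ∈ Γ j l, π j ≤ π x} :
        Finset (Equiv.Perm (Fin n)))) : ℚ) =
        n.factorial / NeQ r #S s := by
    have hset : S.inf' hS (fun l => ({π : Equiv.Perm (Fin n) | ∀ x ∈ Γ j l, π j ≤ π x} :
        Finset (Equiv.Perm (Fin n)))) =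
        ({π : Equiv.Perm (Fin n) | ∀ x ∈ S.biUnion (Γ j), π j ≤ π x} :
          Finset (Equiv.Perm (Fin n))) := by
      ext π
      simp only [Finset.mem_inf', mem_filter, mem_univ, true_and, mem_biUnion]
      grind
    obtain ⟨l, hl⟩ := hS
    have hj : j ∈ S.biUnion (Γ j) := mem_biUnion.2 ⟨l, hl, (h.1 j l).2⟩
    have hmul := card_perm_min_mul_card _ j hj
    rw [hset, ← card_biUnion_of_exactCondition h j S ⟨l, hl⟩,
      eq_div_iff (by exact_mod_cast (card_pos.2 ⟨j, hj⟩).ne')]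
    exact_mod_cast hmul
  have hie := congrArg (Int.cast : ℤ → ℚ) (inclusion_exclusion_card_biUnion univ
    fun l => ({π : Equiv.Perm (Fin n) | ∀ x ∈ Γ j l, π j ≤ π x} : Finset (Equiv.Perm (Fin n))))
  push_cast at hie
  rw [hunion, hie, sum_congr rfl fun S _ => by rw [hinf],
    sum_coe_sort (univ.powerset.filter (·.Nonempty))
      fun S : Finset (Fin t) => (-1 : ℚ) ^ (#S + 1) * (n.factorial / NeQ r #S s)]
  have hfilter : (univ.powerset.filter (·.Nonempty) : Finset (Finset (Fin t))) =
      univ.powerset.filter (fun S => #S ≠ 0) := by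
    ext S
    simp [nonempty_iff_ne_empty]
  rw [hfilter, sum_filter,
    sum_powerset_apply_card (fun k => if k ≠ 0 then (-1 : ℚ) ^ (k + 1) *
      (n.factorial / NeQ r k s) else 0), card_univ, Fintype.card_fin, pe, mul_sum,
    range_eq_Ico, sum_eq_sum_Ico_succ_bot (by omega)]
  simp only [ne_eq, not_true_eq_false, if_false, smul_zero, zero_add]
  refine sum_congr (by ext; simp) fun k hk => ?_
  have hk0 : k ≠ 0 := by simp at hk; omega
  rw [if_pos hk0, nsmul_eq_mul]
  ring

open Finset in
theorem exists_perm_le_card_s8 {n r t s : ℕ} {Γ : Fin n → Fin t → Finset (Fin n)}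
    (h : ExactCondition n r t s Γ) (V : Finset (Fin n)) :
    ∃ π : Equiv.Perm (Fin n),
      (⌈(#V : ℚ) * pe r t s⌉).toNat ≤ #{j ∈ V | ∃ l, ∀ x ∈ Γ j l, π j ≤ π x} := by
  have hsum : ∑ π : Equiv.Perm (Fin n), (#V * pe r t s : ℚ) ≤
      ∑ π : Equiv.Perm (Fin n), (#{j ∈ V | ∃ l, ∀ x ∈ Γ j l, π j ≤ π x} : ℚ) := by
    have hcount := sum_card_bipartiteAbove_eq_sum_card_bipartiteBelow
      (s := (univ : Finset (Equiv.Perm (Fin n)))) (t := V)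
      (fun π j => ∃ l, ∀ x ∈ Γ j l, π j ≤ π x)
    have hcount' := congrArg (Nat.cast : ℕ → ℚ) hcount
    push_cast at hcount'
    unfold bipartiteAbove bipartiteBelow at hcount'
    rw [hcount', sum_congr rfl fun j _ => card_perm_exists_min h j]
    simp only [sum_const, card_univ, Fintype.card_perm, Fintype.card_fin, nsmul_eq_mul]
    exact le_of_eq (by ring)
  obtain ⟨π, -, hπ⟩ := exists_le_of_sum_le univ_nonempty hsum
  refine ⟨π, Int.toNat_le.2 (Int.ceil_le.2 ?_)⟩
  exact_mod_cast hπ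

open Finset in
theorem N1_spec {n r d M : ℕ} (hd : 1 ≤ d) (hdn : d - 1 ≤ n) :
    N1 n r d M ≤ M ∧
    (N1 n r d M : ℚ) * ((r : ℚ) + 1) -
      ((N1 n r d M : ℚ) * ((N1 n r d M : ℚ) - 1)) / ((M : ℚ) * ((M : ℚ) - 1)) *
        ((M : ℚ) * ((r : ℚ) + 1) - (n : ℚ)) ≤ (n : ℚ) - ((d : ℚ) - 1) := by
  obtain ⟨N, hN, hsup⟩ := exists_mem_eq_sup ((range (M + 1)).filter (fun N : ℕ =>
    (N : ℚ) * ((r : ℚ) + 1) -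
      ((N : ℚ) * ((N : ℚ) - 1)) / ((M : ℚ) * ((M : ℚ) - 1)) *
        ((M : ℚ) * ((r : ℚ) + 1) - (n : ℚ))
      ≤ (n : ℚ) - ((d : ℚ) - 1))) ⟨0, by
        have : (d : ℚ) ≤ n + 1 := by exact_mod_cast (by omega : d ≤ n + 1)
        simp
        linarith⟩ id
  have hN1 : N1 n r d M = N := hsup
  rw [hN1]
  simpa [Nat.lt_succ_iff] using hN

open Finset in
theorem exists_recoverable_sequence_avoiding (n r t s d : ℕ)
    (Γ : Fin n → Fin t → Finset (Fin n)) (hexact : ExactCondition n r t s Γ)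
    (hd : 1 ≤ d) (hdn : d - 1 < n)
    (A : Finset (Fin n)) (hA : max (r + 1) (d - 1) ≤ n - A.card)
    (M₀ : ℕ) (hM₀ : M₀ = (⌈((n - A.card : ℕ) : ℚ) * pe r t s⌉).toNat) (hM₀2 : 2 ≤ M₀) :
    ∃ f : Fin ((d - 1) + N1 (n - A.card) r d M₀) → Fin n,
      Function.Injective f ∧ (∀ k, f k ∉ A) ∧
      ∀ k : Fin ((d - 1) + N1 (n - A.card) r d M₀), d ≤ (k : ℕ) + 1 →
        ∃ α : Fin t, ∀ i : Fin ((d - 1) + N1 (n - A.card) r d M₀),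
          i < k → f i ∉ Γ (f k) α := by
  have hV : #Aᶜ = n - #A := by rw [card_compl, Fintype.card_fin]
  obtain ⟨hN, hNle⟩ := N1_spec (r := r) (M := M₀) hd ((le_max_right _ _).trans hA)
  generalize N1 (n - #A) r d M₀ = N at *
  rw [← hV] at hA hM₀ hNle
  obtain ⟨π, hπ⟩ := exists_perm_le_card_s8 hexact Aᶜ
  rw [← hM₀] at hπ
  obtain ⟨B, hBsub, hB⟩ := exists_subset_card_eq hπ
  have hbA (b : Fin n) (hb : b ∈ B) : b ∈ Aᶜ := (mem_filter.1 (hBsub hb)).1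
  have hT (b : Fin n) : ∃ T : Finset (Fin n), b ∈ B →
      (∃ l, (∀ x ∈ Γ b l, π b ≤ π x) ∧ Γ b l ∩ Aᶜ ⊆ T) ∧ T ⊆ Aᶜ ∧ #T = r + 1 := by
    by_cases hb : b ∈ B
    · obtain ⟨l, hl⟩ := (mem_filter.1 (hBsub hb)).2
      obtain ⟨T, hsub, hTA, hTcard⟩ := exists_subsuperset_card_eq (n := r + 1)
        (inter_subset_right : Γ b l ∩ Aᶜ ⊆ Aᶜ)
        ((card_le_card inter_subset_left).trans (hexact.1 b l).1.le)
        ((le_max_left _ _).trans hA)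
      exact ⟨T, fun _ => ⟨⟨l, hl, hsub⟩, hTA, hTcard⟩⟩
    · exact ⟨∅, fun h => absurd h hb⟩
  choose T hT using hT
  obtain ⟨K, hKB, hK, hKle⟩ := exists_subset_card_biUnion_le_s8 B T Aᶜ (r + 1) N
    (fun b hb => (hT b hb).2.1) (fun b hb => (hT b hb).2.2) (hB ▸ hN)
  have hmemT (b : Fin n) (hb : b ∈ K) : b ∈ T b := by
    obtain ⟨l, -, hsub⟩ := (hT b (hKB hb)).1
    exact hsub (mem_inter.2 ⟨(hexact.1 b l).2, hbA b (hKB hb)⟩)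
  have hD : d - 1 ≤ #(Aᶜ \ K.biUnion T) := by
    have hsub : K.biUnion T ⊆ Aᶜ := biUnion_subset.2 fun b hb => (hT b (hKB hb)).2.1
    have hle : (#(K.biUnion T) : ℚ) ≤ (#Aᶜ : ℚ) - ((d : ℚ) - 1) := by
      rw [hB] at hKle
      push_cast at hKle
      exact hKle.trans hNle
    have hle' : #(K.biUnion T) + d ≤ #Aᶜ + 1 := by
      have : (#(K.biUnion T) : ℚ) + d ≤ #Aᶜ + 1 := by linarith
      exact_mod_cast this
    rw [card_sdiff_of_subset hsub]
    omega
  obtain ⟨D, hDsub, hDcard⟩ := exists_subset_card_eq hD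
  have hKimg : #(K.image π) = N := by rw [card_image_of_injective _ π.injective, hK]
  set e : Fin (d - 1) ↪o Fin n := D.orderEmbOfFin hDcard with he
  set g : Fin N → Fin n := fun i => π.symm ((K.image π).orderEmbOfFin hKimg i) with hg
  have heD (i : Fin (d - 1)) : e i ∈ Aᶜ ∧ ∀ b ∈ K, e i ∉ T b := by
    have := mem_sdiff.1 (hDsub (orderEmbOfFin_mem D hDcard i))
    exact ⟨this.1, fun b hb hmem => this.2 (mem_biUnion.2 ⟨b, hb, hmem⟩)⟩
  have hgK (i : Fin N) : g i ∈ K := by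
    obtain ⟨b, hb, hbi⟩ := mem_image.1 (orderEmbOfFin_mem (K.image π) hKimg i)
    simpa [hg, ← hbi] using hb
  have hπg {i k : Fin N} (hik : i < k) : π (g i) < π (g k) := by simpa [hg] using hik
  refine ⟨Fin.append e g, ?_, ?_, ?_⟩
  · rw [Fin.append_injective_iff]
    refine ⟨e.injective, fun i k hik => ?_, fun i k hik => ?_⟩
    · simpa [hg] using hik
    · exact (heD i).2 _ (hgK k) (hik.symm ▸ hmemT _ (hgK k))
  · intro k
    induction k using Fin.addCases with
    | left i => simpa using (heD i).1
    | right i => simpa using hbA _ (hKB (hgK i))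
  · intro k hk
    induction k using Fin.addCases with
    | left i =>
      have := i.isLt
      simp only [Fin.val_castAdd] at hk
      omega
    | right k =>
      obtain ⟨⟨l, hl, hsub⟩, -, -⟩ := hT _ (hKB (hgK k))
      refine ⟨l, fun i hik => ?_⟩
      rw [Fin.append_right]
      induction i using Fin.addCases with
      | left i =>
        rw [Fin.append_left]
        exact fun hmem => (heD i).2 _ (hgK k) (hsub (mem_inter.2 ⟨hmem, (heD i).1⟩))
      | right i =>
        rw [Fin.append_right]
        have hik' : i < k := by simpa using hik
        exact fun hmem => (hπg hik').not_ge (hl _ hmem)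
end

section
/- Let (Γ_l(j))_{1≤l≤t, 1≤j≤n} be a family of subsets of [n] satisfying the exact (r,t,s)-condition, let d be an integer with 1 ≤ d < n, and let A ⊆ [n] be a set with n−|A| ≥ d. Then there exist pairwise distinct j₁,…,j_N ∈ [n]∖A with N = (d−1) + 𝒩₁(n−|A|, d−1, r, t, s) such that for every k with d ≤ k ≤ N there is at least one α ∈ [t] with Γ_α(j_k) ∩ {j₁, j₂, …, j_{k−1}} = ∅. -/
/-- `N_e(r,L,s) = 1 + Lr − s·L(L−1)/2` as an integer. -/
def NeZ (r L s : ℕ) : ℤ :=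
  1 + (L : ℤ) * (r : ℤ) - (s : ℤ) * ((L * (L - 1)) / 2 : ℕ)

/-- The binomial coefficient `C(a,b)` for an integer `a`, with the convention
`C(a,b) = 0` when `a < b`. -/
def chooseQ (a : ℤ) (b : ℕ) : ℚ :=
  if a < (b : ℤ) then 0 else ((a.toNat).choose b : ℚ)

/-- `f̃_e(m,D,r,t,s) = Σ_{L=1}^{t} (−1)^{L+1}·C(t,L)·[C(m−N_e(r,L,s),D)/C(m,D)]·[1/N_e(r,L,s)]`. -/
def fe (m D r t s : ℕ) : ℚ :=
  ∑ L ∈ Finset.Icc 1 t, (-1 : ℚ) ^ (L + 1) * (t.choose L : ℚ) *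
    (chooseQ ((m : ℤ) - NeZ r L s) D / (m.choose D : ℚ)) * (1 / NeQ r L s)

/-- `𝒩₁(m,D,r,t,s)`: the maximum of `⌈m·f̃_e(m,D,r,T,s)⌉` over integers `T`
with `0 ≤ T ≤ t` and `N_e(r,T,s) ≤ m`. -/
def calN1 (m D r t s : ℕ) : ℕ :=
  ((Finset.range (t + 1)).filter (fun T : ℕ => NeZ r T s ≤ (m : ℤ))).sup
    (fun T => (⌈(m : ℚ) * fe m D r T s⌉).toNat)

/-- Inclusion–exclusion when the size of an intersection depends only on the number of sets. -/
theorem card_biUnion_of_inf_card {ι α : Type*} [DecidableEq α] (I : Finset ι)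
    (E : ι → Finset α) (h : ℕ → ℚ)
    (hE : ∀ S ⊆ I, ∀ hS : S.Nonempty, ((S.inf' hS E).card : ℚ) = h S.card) :
    ((I.biUnion E).card : ℚ) =
      ∑ L ∈ Finset.Icc 1 I.card, (-1 : ℚ) ^ (L + 1) * (I.card.choose L : ℚ) * h L := by
  classical
  have key : ((I.biUnion E).card : ℚ) =
      ∑ S ∈ I.powerset.filter (·.Nonempty), (-1 : ℚ) ^ (S.card + 1) * h S.card := by
    have h1 := congrArg (Int.cast : ℤ → ℚ) (Finset.inclusion_exclusion_card_biUnion I E)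
    push_cast at h1
    rw [h1, ← Finset.sum_coe_sort _ fun S : Finset ι => (-1 : ℚ) ^ (S.card + 1) * h S.card]
    refine Finset.sum_congr rfl fun S _ => ?_
    have hS := Finset.mem_filter.1 S.2
    rw [hE S.1 (Finset.mem_powerset.1 hS.1) hS.2]
  rw [key, Finset.sum_filter]
  have h2 : ∀ S ∈ I.powerset,
      (if S.Nonempty then (-1 : ℚ) ^ (S.card + 1) * h S.card else 0) =
        (fun L : ℕ => if 1 ≤ L then (-1 : ℚ) ^ (L + 1) * h L else 0) S.card := fun S _ => by
    simp only [Nat.one_le_iff_ne_zero, Finset.card_ne_zero]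
  rw [Finset.sum_congr rfl h2,
    Finset.sum_powerset_apply_card (fun L : ℕ => if 1 ≤ L then (-1 : ℚ) ^ (L + 1) * h L else 0)]
  symm
  have hsub : Finset.Icc 1 I.card ⊆ Finset.range (I.card + 1) := fun L hL => by
    simp only [Finset.mem_Icc, Finset.mem_range] at *; omega
  refine Finset.sum_subset_zero_on_sdiff hsub (fun L hL => ?_) (fun L hL => ?_)
  · simp only [Finset.mem_Icc, Finset.mem_range, Finset.mem_sdiff] at hL
    rw [if_neg (by omega), smul_zero]
  · simp only [Finset.mem_Icc] at hL
    simp only [if_pos hL.1, nsmul_eq_mul]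
    ring

/-- The size of a union of sets through `j` that pairwise share `s` further points and have no
further triple intersections. -/
theorem card_biUnion_add_choose_two {ι β : Type*} [DecidableEq β] (B : ι → Finset β)
    (j : β) (r s : ℕ) (S : Finset ι) (hS : S.Nonempty)
    (h1 : ∀ l ∈ S, (B l).card = r + 1 ∧ j ∈ B l)
    (h2 : ∀ l₁ ∈ S, ∀ l₂ ∈ S, l₁ ≠ l₂ → (B l₁ ∩ B l₂).card = s + 1)
    (h3 : ∀ l₁ ∈ S, ∀ l₂ ∈ S, ∀ l₃ ∈ S, l₁ ≠ l₂ → l₁ ≠ l₃ → l₂ ≠ l₃ →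
      B l₁ ∩ B l₂ ∩ B l₃ = {j}) :
    (S.biUnion B).card + s * S.card.choose 2 = 1 + S.card * r := by
  classical
  induction hS using Finset.Nonempty.cons_induction with
  | singleton a =>
    simp [(h1 a (Finset.mem_singleton_self a)).1, add_comm]
  | cons a S ha hS ih =>
    have ih := ih (fun l hl => h1 l (Finset.mem_cons_of_mem hl))
      (fun l₁ hl₁ l₂ hl₂ => h2 l₁ (Finset.mem_cons_of_mem hl₁) l₂ (Finset.mem_cons_of_mem hl₂))
      (fun l₁ hl₁ l₂ hl₂ l₃ hl₃ => h3 l₁ (Finset.mem_cons_of_mem hl₁) l₂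
        (Finset.mem_cons_of_mem hl₂) l₃ (Finset.mem_cons_of_mem hl₃))
    have haS : a ∈ Finset.cons a S ha := Finset.mem_cons_self a S
    have hne : ∀ l ∈ S, a ≠ l := fun l hl h => ha (h ▸ hl)
    have hj : j ∈ B a ∩ S.biUnion B := by
      obtain ⟨l, hl⟩ := hS
      exact Finset.mem_inter.2 ⟨(h1 a haS).2,
        Finset.mem_biUnion.2 ⟨l, hl, (h1 l (Finset.mem_cons_of_mem hl)).2⟩⟩
    have hI : (B a ∩ S.biUnion B).card = S.card * s + 1 := by
      have : (B a ∩ S.biUnion B).erase j = S.biUnion fun l => (B a ∩ B l).erase j := by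
        ext x
        simp only [Finset.mem_erase, Finset.mem_inter, Finset.mem_biUnion]
        grind
      rw [← Finset.card_erase_add_one hj, this, Finset.card_biUnion]
      · rw [Finset.sum_const_nat (m := s)]
        intro l hl
        have hjl : j ∈ B a ∩ B l :=
          Finset.mem_inter.2 ⟨(h1 a haS).2, (h1 l (Finset.mem_cons_of_mem hl)).2⟩
        rw [Finset.card_erase_of_mem hjl, h2 a haS l (Finset.mem_cons_of_mem hl) (hne l hl)]
        rfl
      · intro l₁ hl₁ l₂ hl₂ h12
        refine Finset.disjoint_left.2 fun x hx hx' => ?_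
        have := h3 a haS l₁ (Finset.mem_cons_of_mem hl₁) l₂ (Finset.mem_cons_of_mem hl₂)
          (hne _ hl₁) (hne _ hl₂) h12
        have hx3 : x ∈ B a ∩ B l₁ ∩ B l₂ := by
          simp only [Finset.mem_erase, Finset.mem_inter] at *
          tauto
        rw [this, Finset.mem_singleton] at hx3
        exact (Finset.mem_erase.1 hx).1 hx3
    have hu := Finset.card_union_add_card_inter (B a) (S.biUnion B)
    rw [hI, (h1 a haS).1] at hu
    rw [Finset.cons_eq_insert, Finset.biUnion_insert, Finset.card_insert_of_notMem ha,
      Nat.choose_succ_succ' S.card 1, Nat.choose_one_right]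
    nlinarith

section Orderings

variable {α : Type*} [Fintype α] {m : ℕ}

theorem card_filter_ordering_lt (σ : α ≃ Fin m) {D : ℕ} (hD : D ≤ m) :
    (Finset.univ.filter fun v => (σ v : ℕ) < D).card = D := by
  have : (Finset.univ.filter fun v => (σ v : ℕ) < D).card =
      (Finset.univ.filter fun i : Fin m => (i : ℕ) < D).card :=
    Finset.card_equiv σ (by simp)
  rw [this, Fin.card_filter_val_lt, min_eq_right hD]

variable [DecidableEq α]

/-- Orderings in which `W` avoids the first `D` positions. -/
theorem card_orderings_avoiding_mul_choose (hm : Fintype.card α = m) {D : ℕ} (hD : D ≤ m)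
    (W : Finset α) :
    (Finset.univ.filter fun σ : α ≃ Fin m => ∀ w ∈ W, D ≤ (σ w : ℕ)).card * m.choose D =
      (m - W.card).choose D * m.factorial := by
  let firstPts : (α ≃ Fin m) → Finset α := fun σ => Finset.univ.filter fun v => (σ v : ℕ) < D
  let q : Finset α → ℕ := fun S => (Finset.univ.filter fun σ => firstPts σ = S).card
  have hfirst : ∀ σ, (firstPts σ).card = D := fun σ => card_filter_ordering_lt σ hD
  have hq : ∀ S S' : Finset α, S.card = S'.card → q S = q S' := by
    intro S S' h
    obtain ⟨g, rfl⟩ := Equiv.Perm.exists_map_finset_eq S S' h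
    refine Finset.card_equiv (Equiv.equivCongr g (Equiv.refl _)) fun σ => ?_
    simp only [Finset.mem_filter, Finset.mem_univ, true_and, firstPts, Finset.ext_iff]
    rw [← g.forall_congr_right (q := fun v => _ ↔ v ∈ S.map g.toEmbedding)]
    simp
  obtain ⟨S₀, -, hS₀⟩ := Finset.exists_subset_card_eq (s := (Finset.univ : Finset α)) (n := D)
    (by rw [Finset.card_univ, hm]; exact hD)
  have hsum : ∀ X : Finset α, (Finset.univ.filter fun σ => firstPts σ ⊆ X).card =
      X.card.choose D * q S₀ := by
    intro X
    rw [Finset.card_eq_sum_card_fiberwise (f := firstPts) (t := X.powersetCard D),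
      Finset.sum_const_nat (m := q S₀), Finset.card_powersetCard]
    · intro S hS
      rw [Finset.mem_powersetCard] at hS
      rw [← hq S S₀ (hS.2.trans hS₀.symm), Finset.filter_filter]
      congr 1
      ext σ
      simp only [Finset.mem_filter, Finset.mem_univ, true_and, and_iff_right_iff_imp]
      rintro rfl
      exact hS.1
    · intro σ hσ
      simp only [Finset.coe_filter, Finset.mem_univ, true_and, Set.mem_ofPred_eq] at hσ
      exact Finset.mem_powersetCard.2 ⟨hσ, hfirst σ⟩
  have huniv := hsum Finset.univ
  simp only [Finset.subset_univ, Finset.filter_true, Finset.card_univ, hm] at huniv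
  rw [Fintype.card_equiv (Fintype.equivFinOfCardEq hm), hm] at huniv
  have hW := hsum Wᶜ
  rw [Finset.card_compl, hm] at hW
  have : (Finset.univ.filter fun σ : α ≃ Fin m => ∀ w ∈ W, D ≤ (σ w : ℕ)) =
      Finset.univ.filter fun σ => firstPts σ ⊆ Wᶜ := by
    ext σ
    simp only [Finset.mem_filter, Finset.mem_univ, true_and, firstPts, Finset.subset_iff,
      Finset.mem_compl]
    exact forall_congr' fun v => by rw [← not_lt]; tauto
  rw [this, hW, huniv]
  ring

/-- The orderings in which `W` avoids the first `D` positions and `j` comes first in `W`. -/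
def leadingOrderings (m D : ℕ) (W : Finset α) (j : α) : Finset (α ≃ Fin m) :=
  Finset.univ.filter fun σ => ∀ w ∈ W, D ≤ (σ w : ℕ) ∧ σ j ≤ σ w

theorem card_leadingOrderings_eq (D : ℕ) (W : Finset α) {i j : α} (hi : i ∈ W) (hj : j ∈ W) :
    (leadingOrderings m D W i).card = (leadingOrderings m D W j).card := by
  refine Finset.card_equiv (Equiv.equivCongr (Equiv.swap i j) (Equiv.refl _)) fun σ => ?_
  simp only [leadingOrderings, Finset.mem_filter, Finset.mem_univ, true_and]
  rw [← (Equiv.swap i j).forall_congr_right (q := fun w => w ∈ W → D ≤ _ ∧ _)]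
  refine forall_congr' fun w => ?_
  have : Equiv.swap i j w ∈ W ↔ w ∈ W := by
    rw [Equiv.swap_apply_def]
    split_ifs with h h' <;> simp_all
  simp [this]

theorem card_leadingOrderings_mul (hm : Fintype.card α = m) {D : ℕ} (hD : D ≤ m)
    (W : Finset α) {j : α} (hj : j ∈ W) :
    (leadingOrderings m D W j).card * W.card * m.choose D =
      (m - W.card).choose D * m.factorial := by
  rw [← card_orderings_avoiding_mul_choose hm hD W]
  congr 1
  have : (Finset.univ.filter fun σ : α ≃ Fin m => ∀ w ∈ W, D ≤ (σ w : ℕ)) =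
      W.biUnion (leadingOrderings m D W) := by
    ext σ
    simp only [leadingOrderings, Finset.mem_filter, Finset.mem_univ, true_and,
      Finset.mem_biUnion]
    refine ⟨fun h => ?_, fun ⟨i, _, h⟩ w hw => (h w hw).1⟩
    obtain ⟨i, hi, hmin⟩ := Finset.exists_min_image W σ ⟨j, hj⟩
    exact ⟨i, hi, fun w hw => ⟨h w hw, hmin w hw⟩⟩
  rw [this, Finset.card_biUnion, Finset.sum_const_nat (m := (leadingOrderings m D W j).card)]
  · ring
  · exact fun i hi => card_leadingOrderings_eq D W hi hj
  · intro a ha b hb hab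
    refine Finset.disjoint_left.2 fun σ hσ hσ' => ?_
    simp only [leadingOrderings, Finset.mem_filter, Finset.mem_univ, true_and] at hσ hσ'
    exact hab (σ.injective (le_antisymm (hσ b hb).2 (hσ' a ha).2))

/-- The initial segment of an ordering, followed by some later points listed in order. -/
theorem exists_sequence_of_ordering (σ : α ≃ Fin m) {D N : ℕ} (hD : D ≤ m) (J : Finset α)
    (hJ : ∀ j ∈ J, D ≤ (σ j : ℕ)) (hN : N ≤ J.card) :
    ∃ f : Fin (D + N) → α, StrictMono (σ ∘ f) ∧ ∀ k : Fin (D + N), D ≤ (k : ℕ) → f k ∈ J := by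
  obtain ⟨J', hJ', hcard⟩ := Finset.exists_subset_card_eq hN
  let P := (Finset.univ.filter fun v => (σ v : ℕ) < D) ∪ J'
  have hP : (P.map σ.toEmbedding).card = D + N := by
    rw [Finset.card_map, Finset.card_union_of_disjoint, card_filter_ordering_lt σ hD, hcard]
    rw [Finset.disjoint_left]
    intro v hv hv'
    exact absurd (Finset.mem_filter.1 hv).2 (not_lt.2 (hJ v (hJ' hv')))
  let e := (P.map σ.toEmbedding).orderEmbOfFin hP
  refine ⟨fun k => σ.symm (e k), fun a b hab => ?_, fun k hk => ?_⟩
  · simpa using hab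
  · have hle : ∀ (i : ℕ) (hi : i < D + N), i ≤ (e ⟨i, hi⟩ : ℕ) := by
      intro i
      induction i with
      | zero => intro; omega
      | succ i ih =>
        intro hi
        have h1 := ih (by omega)
        have h2 : e ⟨i, by omega⟩ < e ⟨i + 1, hi⟩ := e.strictMono (by simp [Fin.lt_def])
        have h3 := Fin.lt_def.1 h2
        omega
    have hmem : e k ∈ P.map σ.toEmbedding := Finset.orderEmbOfFin_mem _ hP k
    rw [Finset.mem_map_equiv, Finset.mem_union, Finset.mem_filter] at hmem
    rcases hmem with h | h
    · have : (k : ℕ) ≤ e k := hle k k.2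
      simp only [Equiv.apply_symm_apply] at h
      omega
    · exact hJ' h

end Orderings

/-- A set can be mapped injectively into a large enough subtype, fixing the points of the
subtype. -/
theorem exists_injOn_subtype_fixing {β : Type*} [DecidableEq β] (p : β → Prop)
    [DecidablePred p] [Fintype {x // p x}] [Nonempty {x // p x}] (U : Finset β)
    (hU : U.card ≤ Fintype.card {x // p x}) :
    ∃ φ : β → {x // p x}, Set.InjOn φ U ∧ ∀ x : {x // p x}, (x : β) ∈ U → φ x = x := by
  let f : U → {x // p x} := fun x => if h : p x then ⟨x, h⟩ else Classical.arbitrary _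
  let F : Finset U := Finset.univ.filter fun x => p x
  obtain ⟨t, hFt, -, ht⟩ := Finset.exists_subsuperset_card_eq
    (Finset.subset_univ (F.image f)) (Finset.card_image_le.trans
      ((Finset.card_le_univ F).trans_eq (Fintype.card_coe U))) (by rwa [Finset.card_univ])
  obtain ⟨g, hg⟩ := Finset.exists_equiv_extend_of_card_eq (f := f) (s := F)
    ((Fintype.card_coe U).trans ht.symm) hFt (by
      intro x hx y hy hxy
      have hx : p x := by simpa [F] using hx
      have hy : p y := by simpa [F] using hy
      simp only [f, dif_pos hx, dif_pos hy, Subtype.mk.injEq] at hxy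
      exact Subtype.ext hxy)
  refine ⟨fun x => if h : x ∈ U then g ⟨x, h⟩ else Classical.arbitrary _, ?_, ?_⟩
  · intro x hx y hy hxy
    have hx : x ∈ U := hx
    have hy : y ∈ U := hy
    simp only [dif_pos hx, dif_pos hy] at hxy
    simpa using g.injective (Subtype.ext hxy)
  · intro x hx
    simp only [dif_pos hx]
    rw [hg _ (by simpa [F] using x.2)]
    simp [f, x.2]

theorem NeZ_eq_choose (r L s : ℕ) : NeZ r L s = 1 + (L : ℤ) * r - s * (L.choose 2 : ℕ) := by
  rw [NeZ, Nat.choose_two_right]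

theorem NeQ_eq_NeZ (r L s : ℕ) : NeQ r L s = (NeZ r L s : ℚ) := by
  rw [NeZ_eq_choose, NeQ]
  push_cast
  rw [Nat.cast_choose_two]
  ring

theorem chooseQ_natCast_sub {m N D : ℕ} (h : N ≤ m) :
    chooseQ ((m : ℤ) - N) D = ((m - N).choose D : ℚ) := by
  rw [chooseQ, ← Nat.cast_sub h, Int.toNat_natCast]
  split_ifs with hlt
  · rw [Nat.choose_eq_zero_of_lt (by exact_mod_cast hlt), Nat.cast_zero]
  · rfl

/-- The orderings in which `j` leads one of the sets `W l` make up a proportion `fe` of all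
orderings. -/
theorem card_biUnion_leadingOrderings {α ι : Type*} [Fintype α] [DecidableEq α] {m D r s : ℕ}
    (hm : Fintype.card α = m) (hD : D ≤ m) (I : Finset ι) (W : ι → Finset α) (j : α)
    (hj : ∀ l ∈ I, j ∈ W l)
    (hW : ∀ S ⊆ I, S.Nonempty → ((S.biUnion W).card : ℤ) = NeZ r S.card s) :
    ((I.biUnion fun l => leadingOrderings m D (W l) j).card : ℚ) =
      m.factorial * fe m D r I.card s := by
  rw [card_biUnion_of_inf_card I _ (fun L => m.factorial *
    (chooseQ ((m : ℤ) - NeZ r L s) D / (m.choose D : ℚ) * (1 / NeQ r L s))), fe, Finset.mul_sum]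
  · exact Finset.sum_congr rfl fun L _ => by ring
  · intro S hSI hS
    have hinf : S.inf' hS (fun l => leadingOrderings m D (W l) j) =
        leadingOrderings m D (S.biUnion W) j := by
      ext σ
      simp only [Finset.mem_inf', leadingOrderings, Finset.mem_filter, Finset.mem_univ, true_and,
        Finset.mem_biUnion]
      grind
    have hjS : j ∈ S.biUnion W := by
      obtain ⟨l, hl⟩ := hS
      exact Finset.mem_biUnion.2 ⟨l, hl, hj l (hSI hl)⟩
    have hcard := card_leadingOrderings_mul hm hD (S.biUnion W) hjS
    have hle : (S.biUnion W).card ≤ m := hm ▸ Finset.card_le_univ _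
    have hpos : ((S.biUnion W).card : ℚ) ≠ 0 :=
      Nat.cast_ne_zero.2 (Finset.card_ne_zero_of_mem hjS)
    have hchoose : (m.choose D : ℚ) ≠ 0 := Nat.cast_ne_zero.2 (Nat.choose_pos hD).ne'
    rw [hinf, NeQ_eq_NeZ, ← hW S hSI hS, chooseQ_natCast_sub hle, Int.cast_natCast]
    field_simp
    exact_mod_cast (mul_right_comm _ _ _).trans (hcard.trans (mul_comm _ _))

/-- An ordering in which many points lead one of their sets. -/
theorem exists_ordering_many_leading {α ι : Type*} [Fintype α] [DecidableEq α] {m D r s : ℕ}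
    (hm : Fintype.card α = m) (hD : D ≤ m) (I : Finset ι) (W : α → ι → Finset α)
    (hj : ∀ j, ∀ l ∈ I, j ∈ W j l)
    (hW : ∀ j, ∀ S ⊆ I, S.Nonempty → ((S.biUnion (W j)).card : ℤ) = NeZ r S.card s) :
    ∃ (σ : α ≃ Fin m) (J : Finset α), (⌈(m : ℚ) * fe m D r I.card s⌉).toNat ≤ J.card ∧
      ∀ j ∈ J, ∃ l ∈ I, ∀ w ∈ W j l, D ≤ (σ w : ℕ) ∧ σ j ≤ σ w := by
  classical
  let E : α → Finset (α ≃ Fin m) := fun j => I.biUnion fun l => leadingOrderings m D (W j l) j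
  have hE : ∀ j, ((E j).card : ℚ) = m.factorial * fe m D r I.card s := fun j =>
    card_biUnion_leadingOrderings hm hD I (W j) j (hj j) (hW j)
  let e := Fintype.equivFinOfCardEq hm
  have hcount : ∑ σ : α ≃ Fin m, ((Finset.univ.filter fun j => σ ∈ E j).card : ℚ) =
      ∑ _σ : α ≃ Fin m, (m : ℚ) * fe m D r I.card s := by
    have h := Finset.sum_card_bipartiteAbove_eq_sum_card_bipartiteBelow
      (s := (Finset.univ : Finset (α ≃ Fin m))) (t := (Finset.univ : Finset α))
      (fun σ j => σ ∈ E j)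
    simp only [Finset.bipartiteAbove, Finset.bipartiteBelow, Finset.filter_univ_mem] at h
    rw [← Nat.cast_sum, h, Nat.cast_sum, Finset.sum_congr rfl fun j _ => hE j]
    simp only [Finset.sum_const, Finset.card_univ, nsmul_eq_mul, Fintype.card_equiv e, hm]
    ring
  obtain ⟨σ, -, hσ⟩ := Finset.exists_le_of_sum_le ⟨e, Finset.mem_univ e⟩ hcount.ge
  refine ⟨σ, _, Int.toNat_le.2 (Int.ceil_le.2 (by exact_mod_cast hσ)), fun j hjσ => ?_⟩
  simpa [E, leadingOrderings] using hjσ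

theorem exists_recoverable_sequence_avoiding'' (n r t s d : ℕ)
    (Γ : Fin n → Fin t → Finset (Fin n)) (hexact : ExactCondition n r t s Γ)
    (hd : 1 ≤ d) (hdn : d < n)
    (A : Finset (Fin n)) (hA : d ≤ n - A.card) :
    ∃ f : Fin ((d - 1) + calN1 (n - A.card) (d - 1) r t s) → Fin n,
      Function.Injective f ∧ (∀ k, f k ∉ A) ∧
      ∀ k : Fin ((d - 1) + calN1 (n - A.card) (d - 1) r t s), d ≤ (k : ℕ) + 1 →
        ∃ α : Fin t, ∀ i : Fin ((d - 1) + calN1 (n - A.card) (d - 1) r t s),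
          i < k → f i ∉ Γ (f k) α := by
  set m := n - A.card
  have hV : Fintype.card {x // x ∉ A} = m := by
    rw [Fintype.card_subtype_compl, Fintype.card_fin, Fintype.card_coe]
  have hD : d - 1 ≤ m := by omega
  have : Nonempty {x // x ∉ A} := Fintype.card_pos_iff.1 (by omega)
  obtain ⟨T, hT, hsup⟩ := Finset.exists_mem_eq_sup
    ((Finset.range (t + 1)).filter (fun T : ℕ => NeZ r T s ≤ (m : ℤ)))
    ⟨0, Finset.mem_filter.2 ⟨Finset.mem_range.2 t.succ_pos, by simp [NeZ]; omega⟩⟩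
    (fun T => (⌈(m : ℚ) * fe m (d - 1) r T s⌉).toNat)
  have hN : calN1 m (d - 1) r t s = (⌈(m : ℚ) * fe m (d - 1) r T s⌉).toNat := hsup
  rw [Finset.mem_filter, Finset.mem_range] at hT
  obtain ⟨I, -, hI⟩ := Finset.exists_subset_card_eq (s := (Finset.univ : Finset (Fin t))) (n := T)
    (by rw [Finset.card_univ, Fintype.card_fin]; omega)
  obtain ⟨hΓ₁, hΓ₂, hΓ₃⟩ := hexact
  have hunion : ∀ (j : Fin n) (S : Finset (Fin t)), S.Nonempty →
      ((S.biUnion (Γ j)).card : ℤ) = NeZ r S.card s := fun j S hS => by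
    have h := card_biUnion_add_choose_two (Γ j) j r s S hS (fun l _ => hΓ₁ j l)
      (fun l₁ _ l₂ _ => hΓ₂ j l₁ l₂) (fun l₁ _ l₂ _ l₃ _ => hΓ₃ j l₁ l₂ l₃)
    rw [NeZ_eq_choose]
    zify at h
    linarith
  have hle : ∀ j : Fin n, (I.biUnion (Γ j)).card ≤ Fintype.card {x // x ∉ A} := fun j => by
    rcases I.eq_empty_or_nonempty with h | h
    · simp [h]
    · rw [hV, ← Nat.cast_le (α := ℤ), hunion j I h, hI]
      exact hT.2
  choose φ hφinj hφfix using fun j : {x // x ∉ A} =>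
    exists_injOn_subtype_fixing (· ∉ A) (I.biUnion (Γ j)) (hle j)
  have hfix : ∀ (j : {x // x ∉ A}), ∀ l ∈ I, ∀ x : {x // x ∉ A}, (x : Fin n) ∈ Γ j l →
      x ∈ (Γ j l).image (φ j) := fun j l hl x hx =>
    Finset.mem_image.2 ⟨x, hx, hφfix j x (Finset.mem_biUnion.2 ⟨l, hl, hx⟩)⟩
  obtain ⟨σ, J, hJcard, hJ⟩ := exists_ordering_many_leading (r := r) (s := s) hV hD I
    (fun j l => (Γ j l).image (φ j)) (fun j l hl => hfix j l hl j (hΓ₁ j l).2)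
    (fun j S hSI hS => by
      rw [← hunion j S hS, ← Finset.biUnion_image, Finset.card_image_of_injOn]
      exact (hφinj j).mono
        (Finset.coe_subset.2 (Finset.biUnion_subset_biUnion_of_subset_left _ hSI)))
  rw [hI, ← hN] at hJcard
  obtain ⟨f, hf, hfJ⟩ := exists_sequence_of_ordering σ hD J (fun j hj => by
    obtain ⟨l, hl, h⟩ := hJ j hj
    exact (h j (hfix j l hl j (hΓ₁ j l).2)).1) hJcard
  refine ⟨fun k => f k, fun a b hab => hf.injective (congrArg σ (Subtype.ext hab)),
    fun k => (f k).2, fun k hk => ?_⟩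
  obtain ⟨l, hl, h⟩ := hJ (f k) (hfJ k (by omega))
  exact ⟨l, fun i hik hmem => absurd (hf hik) (not_lt.2 (h (f i) (hfix _ l hl _ hmem)).2)⟩
end
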